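/- arXiv:1905.00340 — 2 statements merged into one kernel-verified Lean document; each statement's English description precedes it below -/
import Mathlib

section
/- Let G be a finite simple graph, M a module of G, and S, S' independent sets of G with |S| = |S'|, M ∩ S = {u}, M ∩ S' = {v}, u ≠ v, and such that u and v lie in different connected components of the induced subgraph G[M]. Then S ↭ S' in G (under token sliding) if and only if both (a) S ↭ (S' ∖ {v}) ∪ {u} in G − v, and (b) there exists an independent set T of G − v with T ∩ M = ∅ and S ↭ T in G − v. -/
open Finset

variable {V : Type*}

/-- `S` is an independent set of the simple graph `G`. -/
def IndepF (G : SimpleGraph V) (S : Finset V) : Prop :=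
  ∀ u ∈ S, ∀ v ∈ S, ¬ G.Adj u v

/-- A single `TAR_k` step inside the induced subgraph `G[W]`:
both sets are independent sets of `G` contained in `W`, their symmetric
difference has at most one element, and both have size at least `k`. -/
def TarStepOn [DecidableEq V] (G : SimpleGraph V) (W : Set V) (k : ℤ)
    (A B : Finset V) : Prop :=
  (A : Set V) ⊆ W ∧ (B : Set V) ⊆ W ∧ IndepF G A ∧ IndepF G B ∧
    (symmDiff A B).card ≤ 1 ∧ k ≤ (A.card : ℤ) ∧ k ≤ (B.card : ℤ)

/-- `TAR_k` reachability inside the induced subgraph `G[W]`. -/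
def TarReachOn [DecidableEq V] (G : SimpleGraph V) (W : Set V) (k : ℤ) :
    Finset V → Finset V → Prop :=
  Relation.ReflTransGen (TarStepOn G W k)

/-- A single token-sliding step inside the induced subgraph `G[W]`. -/
def TsStepOn [DecidableEq V] (G : SimpleGraph V) (W : Set V) (A B : Finset V) : Prop :=
  (A : Set V) ⊆ W ∧ (B : Set V) ⊆ W ∧ IndepF G A ∧ IndepF G B ∧
    ∃ x y, G.Adj x y ∧ symmDiff A B = {x, y}

/-- Token-sliding (`TS`) reachability inside the induced subgraph `G[W]`. -/
def TsReachOn [DecidableEq V] (G : SimpleGraph V) (W : Set V) :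
    Finset V → Finset V → Prop :=
  Relation.ReflTransGen (TsStepOn G W)

/-- `M` is a module of `G`. -/
def IsModule [DecidableEq V] (G : SimpleGraph V) (M : Finset V) : Prop :=
  ∀ u ∈ M, ∀ v ∈ M, ∀ w, w ∉ M → (G.Adj u w ↔ G.Adj v w)

/-- The open neighborhood `N(M)` of the vertex set `M`: vertices outside `M`
adjacent to some vertex of `M`. -/
def NbhdSet (G : SimpleGraph V) (M : Finset V) : Set V :=
  {w | w ∉ M ∧ ∃ v ∈ M, G.Adj v w}

/-- `lam G W S k` : the largest size of an independent set reachable from `S`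
under `TAR_k` inside the induced subgraph `G[W]`. -/
noncomputable def lam [DecidableEq V] (G : SimpleGraph V) (W : Set V)
    (S : Finset V) (k : ℤ) : ℕ :=
  sSup {n | ∃ T : Finset V, TarReachOn G W k S T ∧ T.card = n}

/-- A single token-jumping step: both sets are independent, of equal size,
and their symmetric difference has exactly two elements. -/
def TjStep [DecidableEq V] (G : SimpleGraph V) (A B : Finset V) : Prop :=
  IndepF G A ∧ IndepF G B ∧ A.card = B.card ∧ (symmDiff A B).card = 2

/-- Token-jumping (`TJ`) reachability. -/
def TjReach [DecidableEq V] (G : SimpleGraph V) : Finset V → Finset V → Prop :=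
  Relation.ReflTransGen (TjStep G)

theorem TsStepOn.symm [DecidableEq V] {G : SimpleGraph V} {W : Set V} {A B : Finset V}
    (h : TsStepOn G W A B) : TsStepOn G W B A := by
  obtain ⟨hA, hB, iA, iB, x, y, hxy, hs⟩ := h
  exact ⟨hB, hA, iB, iA, x, y, hxy, by rwa [symmDiff_comm]⟩

theorem TsReachOn.symm [DecidableEq V] {G : SimpleGraph V} {W : Set V} {A B : Finset V}
    (h : TsReachOn G W A B) : TsReachOn G W B A := by
  induction h with
  | refl => exact Relation.ReflTransGen.refl
  | tail _ h2 ih => exact Relation.ReflTransGen.head h2.symm ih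

theorem TsReachOn.mono [DecidableEq V] {G : SimpleGraph V} {W W' : Set V} (hW : W ⊆ W')
    {A B : Finset V} (h : TsReachOn G W A B) : TsReachOn G W' A B :=
  Relation.ReflTransGen.mono
    (fun _ _ h => ⟨h.1.trans hW, h.2.1.trans hW, h.2.2⟩ : TsStepOn G W ≤ TsStepOn G W') A B h

/-- A token-sliding step moves one token along an edge. -/
theorem TsStepOn.exists_slide [DecidableEq V] {G : SimpleGraph V} {W : Set V} {A B : Finset V}
    (h : TsStepOn G W A B) :
    ∃ x y, G.Adj x y ∧ x ∈ A ∧ y ∉ A ∧ B = insert y (A.erase x) := by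
  obtain ⟨-, -, iA, iB, x, y, hxy, hs⟩ := h
  have key : ∀ a, (a ∈ A ∧ a ∉ B ∨ a ∈ B ∧ a ∉ A) ↔ (a = x ∨ a = y) := fun a => by
    rw [← Finset.mem_symmDiff, hs]; simp
  have hne := hxy.ne
  have hA : ¬ (x ∈ A ∧ y ∈ A) := fun h => iA x h.1 y h.2 hxy
  have hB : ¬ (x ∈ B ∧ y ∈ B) := fun h => iB x h.1 y h.2 hxy
  by_cases hx : x ∈ A
  · refine ⟨x, y, hxy, hx, fun hy => hA ⟨hx, hy⟩, ?_⟩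
    ext a
    have := key a
    have := key x
    have := key y
    grind
  · refine ⟨y, x, hxy.symm, ?_, hx, ?_⟩
    · have := key x
      have := key y
      grind
    · ext a
      have := key a
      have := key x
      have := key y
      grind

/-- Replace the tokens of `A` inside `M`, if there are any, by a single token on `m`. -/
def moveToken [DecidableEq V] (M : Finset V) (m : V) (A : Finset V) : Finset V :=
  if A ∩ M = ∅ then A else insert m (A \ M)

theorem moveToken_of_disjoint [DecidableEq V] {M A : Finset V} (m : V) (h : A ∩ M = ∅) :
    moveToken M m A = A := if_pos h

theorem moveToken_of_mem [DecidableEq V] {M A : Finset V} (m : V) {a : V} (hA : a ∈ A)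
    (hM : a ∈ M) : moveToken M m A = insert m (A \ M) :=
  if_neg (Finset.ne_empty_of_mem (Finset.mem_inter.2 ⟨hA, hM⟩))

theorem moveToken_subset [DecidableEq V] {M A : Finset V} {m : V} {W : Set V} (hm : m ∈ W)
    (hW : (M : Set V)ᶜ ⊆ W) : (moveToken M m A : Set V) ⊆ W := by
  intro a ha
  by_cases haM : a ∈ M
  · have : a = m := by
      unfold moveToken at ha
      split_ifs at ha with h
      · exact absurd (Finset.mem_inter.2 ⟨ha, haM⟩) (by simp [h])
      · simpa [haM] using ha
    exact this ▸ hm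
  · exact hW haM

theorem IndepF.moveToken [DecidableEq V] {G : SimpleGraph V} {M A : Finset V} {m : V}
    (hM : IsModule G M) (hm : m ∈ M) (hA : IndepF G A) : IndepF G (moveToken M m A) := by
  by_cases h : A ∩ M = ∅
  · rwa [moveToken_of_disjoint m h]
  · obtain ⟨c, hc⟩ := Finset.nonempty_iff_ne_empty.2 h
    rw [Finset.mem_inter] at hc
    rw [moveToken_of_mem m hc.1 hc.2]
    have hmA : ∀ a ∈ A, a ∉ M → ¬ G.Adj m a := fun a ha haM hadj =>
      hA c hc.1 a ha ((hM m hm c hc.2 a haM).1 hadj)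
    intro a ha b hb hab
    simp only [Finset.mem_insert, Finset.mem_sdiff] at ha hb
    rcases ha with rfl | ha <;> rcases hb with rfl | hb
    · exact hab.ne rfl
    · exact hmA b hb.1 hb.2 hab
    · exact hmA a ha.1 ha.2 hab.symm
    · exact hA a ha.1 b hb.1 hab

/-- If a module holds at most one token, then this remains true after a sliding step: no token can
enter an occupied module. -/
theorem TsStepOn.inter_card_le_one [DecidableEq V] {G : SimpleGraph V} {M A B : Finset V}
    {W : Set V} (hM : IsModule G M) (h : TsStepOn G W A B) (hA : (A ∩ M).card ≤ 1) :
    (B ∩ M).card ≤ 1 := by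
  have iA := h.2.2.1
  obtain ⟨x, y, hxy, hx, hy, rfl⟩ := h.exists_slide
  simp only [Finset.card_le_one, Finset.mem_inter] at hA ⊢
  have hmod : y ∈ M → x ∉ M → ∀ a ∈ A, a ∉ M := fun hyM hxM a ha haM =>
    iA a ha x hx ((hM y hyM a haM x hxM).1 hxy.symm)
  grind

/-- Moving the token inside a module to a fixed vertex `m` preserves sliding steps. -/
theorem TsStepOn.reach_moveToken [DecidableEq V] {G : SimpleGraph V} {M A B : Finset V} {m : V}
    {W W' : Set V} (hM : IsModule G M) (hm : m ∈ M) (hmW : m ∈ W') (hW : (M : Set V)ᶜ ⊆ W')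
    (h : TsStepOn G W A B) (hA : (A ∩ M).card ≤ 1) :
    TsReachOn G W' (moveToken M m A) (moveToken M m B) := by
  have hB := h.inter_card_le_one hM hA
  have iA := h.2.2.1
  have iB := h.2.2.2.1
  have single : ∀ x y, G.Adj x y →
      symmDiff (moveToken M m A) (moveToken M m B) = {x, y} →
      TsReachOn G W' (moveToken M m A) (moveToken M m B) := fun x y hxy hs =>
    Relation.ReflTransGen.single ⟨moveToken_subset hmW hW, moveToken_subset hmW hW,
      iA.moveToken hM hm, iB.moveToken hM hm, x, y, hxy, hs⟩
  obtain ⟨x, y, hxy, hx, hy, rfl⟩ := h.exists_slide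
  simp only [Finset.card_le_one, Finset.mem_inter] at hA hB
  have hne := hxy.ne
  by_cases hxM : x ∈ M <;> by_cases hyM : y ∈ M
  · have : moveToken M m A = moveToken M m (insert y (A.erase x)) := by
      rw [moveToken_of_mem m hx hxM, moveToken_of_mem m (Finset.mem_insert_self _ _) hyM]
      ext a; grind
    rw [this]
    exact Relation.ReflTransGen.refl
  · apply single m y ((hM m hm x hxM y hyM).2 hxy)
    rw [moveToken_of_mem m hx hxM, moveToken_of_disjoint]
    · ext a
      simp only [Finset.mem_symmDiff]
      grind
    · ext a; grind
  · have hdisj : ∀ a ∈ A, a ∉ M := fun a ha haM =>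
      iA a ha x hx ((hM y hyM a haM x hxM).1 hxy.symm)
    apply single x m ((hM m hm y hyM x hxM).2 hxy.symm).symm
    rw [moveToken_of_mem m (Finset.mem_insert_self _ _) hyM, moveToken_of_disjoint]
    · ext a
      simp only [Finset.mem_symmDiff]
      grind
    · ext a; grind
  · apply single x y hxy
    by_cases hAM : A ∩ M = ∅
    · rw [moveToken_of_disjoint m hAM, moveToken_of_disjoint]
      · ext a
        simp only [Finset.mem_symmDiff]
        grind
      · rw [← hAM]; ext a; grind
    · obtain ⟨c, hc⟩ := Finset.nonempty_iff_ne_empty.2 hAM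
      rw [Finset.mem_inter] at hc
      rw [moveToken_of_mem m hc.1 hc.2,
        moveToken_of_mem m (a := c) (by grind) hc.2]
      ext a
      simp only [Finset.mem_symmDiff]
      grind

theorem TsReachOn.inter_card_le_one [DecidableEq V] {G : SimpleGraph V} {M A B : Finset V}
    {W : Set V} (hM : IsModule G M) (h : TsReachOn G W A B) (hA : (A ∩ M).card ≤ 1) :
    (B ∩ M).card ≤ 1 := by
  induction h with
  | refl => exact hA
  | tail _ h2 ih => exact h2.inter_card_le_one hM ih

theorem TsReachOn.moveToken [DecidableEq V] {G : SimpleGraph V} {M A B : Finset V} {m : V}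
    {W W' : Set V} (hM : IsModule G M) (hm : m ∈ M) (hmW : m ∈ W') (hW : (M : Set V)ᶜ ⊆ W')
    (h : TsReachOn G W A B) (hA : (A ∩ M).card ≤ 1) :
    TsReachOn G W' (moveToken M m A) (moveToken M m B) := by
  induction h with
  | refl => exact Relation.ReflTransGen.refl
  | tail h1 h2 ih =>
    exact ih.trans (h2.reach_moveToken hM hm hmW hW (TsReachOn.inter_card_le_one hM h1 hA))

theorem TsReachOn.indepF [DecidableEq V] {G : SimpleGraph V} {W : Set V} {A B : Finset V}
    (h : TsReachOn G W A B) (hA : IndepF G A) : IndepF G B := by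
  induction h with
  | refl => exact hA
  | tail _ h2 _ => exact h2.2.2.2.1

/-- If the module `M` is never emptied, the token inside `M` stays in its connected component
of `G[M]`. -/
theorem TsReachOn.exists_disjoint_or_reachable [DecidableEq V] {G : SimpleGraph V}
    {M A B : Finset V} {W : Set V} (hM : IsModule G M) {u : V} (hu : u ∈ M)
    (hA : A ∩ M = {u}) (h : TsReachOn G W A B) :
    (∃ T, TsReachOn G W A T ∧ T ∩ M = ∅) ∨
      ∀ w ∈ B, ∀ hw : w ∈ M, (G.induce {x : V | x ∈ M}).Reachable ⟨u, hu⟩ ⟨w, hw⟩ := by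
  induction h with
  | refl =>
    right
    intro w hwA hw
    obtain rfl : w = u := by simpa [hA] using Finset.mem_inter.2 ⟨hwA, hw⟩
    exact SimpleGraph.Reachable.refl _
  | @tail X Y h1 h2 ih =>
    rcases ih with ih | ih
    · exact Or.inl ih
    by_cases hX : X ∩ M = ∅
    · exact Or.inl ⟨X, h1, hX⟩
    right
    intro w hwY hw
    have iX := h2.2.2.1
    obtain ⟨x, y, hxy, hx, hy, rfl⟩ := h2.exists_slide
    rw [Finset.mem_insert] at hwY
    rcases hwY with rfl | hwX
    · obtain ⟨c, hc⟩ := Finset.nonempty_iff_ne_empty.2 hX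
      rw [Finset.mem_inter] at hc
      have hxM : x ∈ M := by
        by_contra hxM
        exact iX c hc.1 x hx ((hM w hw c hc.2 x hxM).1 hxy.symm)
      refine (ih x hx hxM).trans (SimpleGraph.Adj.reachable ?_)
      exact hxy
    · exact ih w (Finset.mem_of_mem_erase hwX) hw

/-- Let `M` be a module of `G` and `S, S'` independent sets of
`G` with `|S| = |S'|`, `M ∩ S = {u}`, `M ∩ S' = {v}`, `u ≠ v`, and `u`, `v`
in different connected components of `G[M]`. Then `S ↭ S'` in `G` under
token sliding iff both (a) `S ↭ (S' \ {v}) ∪ {u}` in `G - v`, and (b) there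
is an independent set `T` of `G - v` with `T ∩ M = ∅` and `S ↭ T` in
`G - v`. -/
theorem stmt11 {V : Type*} [Fintype V] [DecidableEq V] (G : SimpleGraph V)
    (M : Finset V) (hM : IsModule G M)
    (S S' : Finset V) (hS : IndepF G S) (hS' : IndepF G S')
    (hcard : S.card = S'.card)
    (u v : V) (huM : u ∈ M) (hvM : v ∈ M)
    (hSu : M ∩ S = {u}) (hS'v : M ∩ S' = {v}) (huv : u ≠ v)
    (hcomp : ¬ (G.induce {x : V | x ∈ M}).Reachable ⟨u, huM⟩ ⟨v, hvM⟩) :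
    TsReachOn G Set.univ S S' ↔
      (TsReachOn G ({v}ᶜ : Set V) S ((S' \ {v}) ∪ {u}) ∧
        ∃ T : Finset V, IndepF G T ∧ v ∉ T ∧ T ∩ M = ∅ ∧
          TsReachOn G ({v}ᶜ : Set V) S T) := by
  have hSM : S ∩ M = {u} := by rw [Finset.inter_comm, hSu]
  have hS'M : S' ∩ M = {v} := by rw [Finset.inter_comm, hS'v]
  have huS : ∀ a, a ∈ S ∧ a ∈ M ↔ a = u := fun a => by
    rw [← Finset.mem_inter, hSM, Finset.mem_singleton]
  have hvS' : ∀ a, a ∈ S' ∧ a ∈ M ↔ a = v := fun a => by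
    rw [← Finset.mem_inter, hS'M, Finset.mem_singleton]
  have hScard : (S ∩ M).card ≤ 1 := by simp [hSM]
  have hSmove : moveToken M u S = S := by
    rw [moveToken_of_mem u ((huS u).2 rfl).1 huM]
    ext a
    have := huS a
    grind
  have hS'move : moveToken M u S' = (S' \ {v}) ∪ {u} := by
    rw [moveToken_of_mem u ((hvS' v).2 rfl).1 hvM]
    ext a
    have := hvS' a
    grind
  have huW : u ∈ ({v}ᶜ : Set V) := huv
  have hMW : (M : Set V)ᶜ ⊆ ({v}ᶜ : Set V) := by
    simpa using hvM
  constructor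
  · intro h
    refine ⟨?_, ?_⟩
    · have := h.moveToken hM huM huW hMW hScard
      rwa [hSmove, hS'move] at this
    · rcases h.exists_disjoint_or_reachable hM huM hSM with ⟨T, hT, hTM⟩ | hr
      · refine ⟨T, hT.indepF hS, ?_, hTM, ?_⟩
        · intro hvT
          exact Finset.notMem_empty v (hTM ▸ Finset.mem_inter.2 ⟨hvT, hvM⟩)
        · have := hT.moveToken hM huM huW hMW hScard
          rwa [hSmove, moveToken_of_disjoint u hTM] at this
      · exact absurd (hr v ((hvS' v).2 rfl).1 hvM) hcomp
  · rintro ⟨ha, T, -, -, hTM, hT⟩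
    have hcard' := ha.inter_card_le_one hM hScard
    have hback : moveToken M v ((S' \ {v}) ∪ {u}) = S' := by
      rw [moveToken_of_mem v (a := u) (by simp) huM]
      ext a
      have := hvS' a
      grind
    have hTS' := TsReachOn.moveToken hM hvM (Set.mem_univ v) (Set.subset_univ _)
      (ha.symm.trans hT) hcard'
    rw [hback, moveToken_of_disjoint v hTM] at hTS'
    exact (hT.mono (Set.subset_univ _)).trans hTS'.symm
end

section
/- Let G be a finite simple graph, k an integer, and S an independent set of G that has maximum size among all independent sets TAR_k-reachable from S (i.e., |S| = λ(G, S, k)). If T is an independent set of G with S ↭_k T in G, then for every connected component C of G, (S ∩ C) ↭_{k'} (T ∩ C) in the induced subgraph G[C], where k' = max(k − |S ∖ C|, 0). -/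
open Finset

variable {V : Type*}

theorem card_le_lam_of_tarReachOn {V : Type*} [Fintype V] [DecidableEq V] {G : SimpleGraph V}
    {W : Set V} {k : ℤ} {S T : Finset V} (h : TarReachOn G W k S T) : T.card ≤ lam G W S k :=
  le_csSup ⟨Fintype.card V, by rintro n ⟨A, -, rfl⟩; exact A.card_le_univ⟩ ⟨T, h, rfl⟩

theorem IndepF.mono {V : Type*} {G : SimpleGraph V} {A B : Finset V} (hB : IndepF G B)
    (hAB : A ⊆ B) : IndepF G A :=
  fun u hu v hv => hB u (hAB hu) v (hAB hv)

theorem IndepF.filter_union_filter_not {V : Type*} [DecidableEq V] {G : SimpleGraph V}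
    {p : V → Prop} [DecidablePred p] (hp : ∀ u v, G.Adj u v → (p u ↔ p v)) {A B : Finset V}
    (hA : IndepF G A) (hB : IndepF G B) :
    IndepF G (A.filter p ∪ B.filter (fun x => ¬ p x)) := by
  intro u hu v hv huv
  have := hp u v huv
  have := hA u
  have := hB u
  simp only [mem_union, mem_filter] at hu hv
  grind

theorem card_filter_union_filter_not {V : Type*} [DecidableEq V] (p : V → Prop)
    [DecidablePred p] (A B : Finset V) :
    (A.filter p ∪ B.filter (fun x => ¬ p x)).card =
      (A.filter p).card + (B.filter (fun x => ¬ p x)).card :=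
  card_union_of_disjoint (disjoint_filter_filter_not A B p)

theorem filter_eq_or_filter_not_eq_of_card_symmDiff_le_one {V : Type*} [DecidableEq V]
    (p : V → Prop) [DecidablePred p] {A B : Finset V} (h : (symmDiff A B).card ≤ 1) :
    A.filter p = B.filter p ∨ A.filter (fun x => ¬ p x) = B.filter (fun x => ¬ p x) := by
  rw [card_le_one] at h
  by_contra! hne
  obtain ⟨h₁, h₂⟩ := hne
  simp only [ne_eq, Finset.ext_iff, mem_filter, not_forall] at h₁ h₂
  obtain ⟨x, hx⟩ := h₁
  obtain ⟨y, hy⟩ := h₂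
  have := h x (by rw [mem_symmDiff]; tauto) y (by rw [mem_symmDiff]; tauto)
  subst this
  tauto

/-- If `A` is dominated by `S` outside `p`, then a step from `A` to `B` can be replayed on the
`p`-part alone, with the rest frozen as in `S`. -/
theorem TarStepOn.filter_union_filter_not {V : Type*} [DecidableEq V] {G : SimpleGraph V} {k : ℤ}
    {p : V → Prop} [DecidablePred p] (hp : ∀ u v, G.Adj u v → (p u ↔ p v)) {S A B : Finset V}
    (hS : IndepF G S) (h : TarStepOn G Set.univ k A B)
    (hA : (A.filter (fun x => ¬ p x)).card ≤ (S.filter (fun x => ¬ p x)).card) :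
    TarStepOn G Set.univ k (A.filter p ∪ S.filter (fun x => ¬ p x))
      (B.filter p ∪ S.filter (fun x => ¬ p x)) := by
  obtain ⟨-, -, iA, iB, hd, kA, kB⟩ := h
  refine ⟨Set.subset_univ _, Set.subset_univ _, iA.filter_union_filter_not hp hS,
    iB.filter_union_filter_not hp hS, (card_le_card ?_).trans hd, ?_, ?_⟩
  · intro x
    simp only [mem_symmDiff, mem_union, mem_filter]
    tauto
  all_goals
    rw [card_filter_union_filter_not]
    have eA := card_filter_add_card_filter_not (s := A) p
    have eB := card_filter_add_card_filter_not (s := B) p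
    obtain e | e := filter_eq_or_filter_not_eq_of_card_symmDiff_le_one p hd <;>
      have := congrArg card e <;> omega

/-- A vertex set `p` with no edges leaving it splits a `TAR` sequence that starts at a set of
maximum reachable size: no part ever exceeds its initial size, and each part can be reconfigured
with the other one frozen. -/
theorem TarReachOn.split_of_card_eq_lam {V : Type*} [Fintype V] [DecidableEq V]
    {G : SimpleGraph V} {k : ℤ} {p : V → Prop} [DecidablePred p]
    (hp : ∀ u v, G.Adj u v → (p u ↔ p v)) {S T : Finset V} (hS : IndepF G S)
    (hmax : S.card = lam G Set.univ S k) (h : TarReachOn G Set.univ k S T) :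
    (TarReachOn G Set.univ k S (T.filter p ∪ S.filter (fun x => ¬ p x)) ∧
      (T.filter p).card ≤ (S.filter p).card) ∧
    (TarReachOn G Set.univ k S (S.filter p ∪ T.filter (fun x => ¬ p x)) ∧
      (T.filter (fun x => ¬ p x)).card ≤ (S.filter (fun x => ¬ p x)).card) := by
  have eS := card_filter_add_card_filter_not (s := S) p
  induction h with
  | refl => simpa only [filter_union_filter_not_eq, le_refl, and_true, and_self] using .refl
  | @tail A B _ hAB ih =>
    obtain ⟨⟨r₁, c₁⟩, r₂, c₂⟩ := ih
    have r₁' := r₁.tail (hAB.filter_union_filter_not hp hS c₂)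
    have r₂' : TarReachOn G Set.univ k S (S.filter p ∪ B.filter (fun x => ¬ p x)) := by
      refine r₂.tail ?_
      have := hAB.filter_union_filter_not (p := fun x => ¬ p x)
        (fun u v huv => not_congr (hp u v huv)) hS (by simpa only [not_not] using c₁)
      simpa only [not_not, union_comm] using this
    have l₁ := card_le_lam_of_tarReachOn r₁'
    have l₂ := card_le_lam_of_tarReachOn r₂'
    rw [card_filter_union_filter_not] at l₁ l₂
    exact ⟨⟨r₁', by omega⟩, r₂', by omega⟩

theorem TarReachOn.filter_of_card_eq_lam {V : Type*} [Fintype V] [DecidableEq V]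
    {G : SimpleGraph V} {k : ℤ} {p : V → Prop} [DecidablePred p]
    (hp : ∀ u v, G.Adj u v → (p u ↔ p v)) {S T : Finset V} (hS : IndepF G S)
    (hmax : S.card = lam G Set.univ S k) (h : TarReachOn G Set.univ k S T) :
    TarReachOn G {x | p x} (max (k - ((S.filter (fun x => ¬ p x)).card : ℤ)) 0)
      (S.filter p) (T.filter p) := by
  induction h with
  | refl => exact .refl
  | @tail A B hA hAB ih =>
    have cA := (TarReachOn.split_of_card_eq_lam hp hS hmax hA).2.2
    have cB := (TarReachOn.split_of_card_eq_lam hp hS hmax (hA.tail hAB)).2.2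
    obtain ⟨-, -, iA, iB, hd, kA, kB⟩ := hAB
    have eA := card_filter_add_card_filter_not (s := A) p
    have eB := card_filter_add_card_filter_not (s := B) p
    refine ih.tail ⟨fun x hx => (mem_filter.1 hx).2, fun x hx => (mem_filter.1 hx).2,
      iA.mono (filter_subset _ _), iB.mono (filter_subset _ _), (card_le_card ?_).trans hd,
      by omega, by omega⟩
    intro x
    simp only [mem_symmDiff, mem_filter]
    tauto

open scoped Classical in
/-- Let `S` be an independent set of `G` of maximum size among
all independent sets `TAR_k`-reachable from `S` (i.e. `|S| = λ(G,S,k)`). If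
`T` is an independent set of `G` with `S ↭_k T` in `G`, then for every
connected component `C` of `G`, `(S ∩ C) ↭_{k'} (T ∩ C)` in `G[C]`, where
`k' = max(k - |S \ C|, 0)`. -/
theorem stmt16 {V : Type*} [Fintype V] [DecidableEq V] (G : SimpleGraph V)
    (k : ℤ) (S : Finset V) (hS : IndepF G S)
    (hmax : S.card = lam G Set.univ S k)
    (T : Finset V) (hT : IndepF G T)
    (hreach : TarReachOn G Set.univ k S T) :
    ∀ c : G.ConnectedComponent,
      TarReachOn G c.supp
        (max (k - ((S.filter (fun x => G.connectedComponentMk x ≠ c)).card : ℤ)) 0)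
        (S.filter (fun x => G.connectedComponentMk x = c))
        (T.filter (fun x => G.connectedComponentMk x = c)) := by
  intro c
  convert TarReachOn.filter_of_card_eq_lam (p := fun x => G.connectedComponentMk x = c)
    (fun u v huv => by rw [SimpleGraph.ConnectedComponent.connectedComponentMk_eq_of_adj huv])
    hS hmax hreach
  rfl
end
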